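/- Let F be a field and M a k×k matrix over F (not necessarily symmetric) such that det(I_k + P·M) = 0 for every k×k permutation matrix P (i.e., −1 is an eigenvalue of P·M for every permutation matrix P). Then (k−1)!·( k + Σ_{i,j=1}^{k} M_{ij} ) = 0 in F. Consequently, if the characteristic of F is 0 or is at least k, then Σ_{i,j=1}^{k} M_{ij} = −k; in particular, every field of characteristic 0 or of characteristic at least k satisfies condition Π_k. -/

import Mathlib

open Matrix

/-- The permutation matrix of `σ`: the `(i, j)` entry is `1` if `σ j = i` and `0` otherwise. -/
def permMat (F : Type*) [Zero F] [One F] {n : Type*} [DecidableEq n]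
    (σ : Equiv.Perm n) : Matrix n n F :=
  Matrix.of fun i j => if σ j = i then 1 else 0

/-- A matrix `G` over a field is an LCED matrix if there is a permutation matrix `P`
such that `G * P * Gᵀ` is invertible. -/
def IsLCEDMatrix {F : Type*} [Field F] {k n : Type*} [Fintype k] [Fintype n]
    [DecidableEq k] [DecidableEq n] (G : Matrix k n F) : Prop :=
  ∃ σ : Equiv.Perm n, IsUnit (G * permMat F σ * Gᵀ)

/-- A field `F` satisfies condition `Π_k` if every symmetric `k × k` matrix `M` such that
`-1` is an eigenvalue of `P * M` for every permutation matrix `P` has the sum of all of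
its entries equal to `-k`. -/
def PiCond (F : Type*) [Field F] (k : ℕ) : Prop :=
  ∀ M : Matrix (Fin k) (Fin k) F, M.IsSymm →
    (∀ σ : Equiv.Perm (Fin k), ((1 : Matrix (Fin k) (Fin k) F) + permMat F σ * M).det = 0) →
    ∑ i, ∑ j, M i j = -(k : F)

theorem permMat_mul_apply_aux {F : Type*} [Field F] {k : ℕ} (σ : Equiv.Perm (Fin k))
    (M : Matrix (Fin k) (Fin k) F) (i j : Fin k) :
    (permMat F σ * M) i j = M (σ⁻¹ i) j := by
  rw [Matrix.mul_apply, Finset.sum_eq_single (σ⁻¹ i)]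
  · simp [permMat]
  · intro b _ hb
    have : σ b ≠ i := by
      rintro rfl
      simp at hb
    simp [permMat, this]
  · simp

theorem sum_perm_apply_aux {F : Type*} [Field F] {n : ℕ} (g : Fin (n + 1) → F)
    (i : Fin (n + 1)) :
    ∑ ρ : Equiv.Perm (Fin (n + 1)), g (ρ i) = (n.factorial : F) * ∑ j, g j := by
  have h0 : ∑ ρ : Equiv.Perm (Fin (n + 1)), g (ρ 0) = (n.factorial : F) * ∑ j, g j := by
    rw [← Equiv.sum_comp Equiv.Perm.decomposeFin.symm, Fintype.sum_prod_type]
    simp [Fintype.card_perm, Finset.mul_sum]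
  rw [← h0, ← Equiv.sum_comp (Equiv.mulRight (Equiv.swap 0 i))]
  simp

theorem sum_det_aux {F : Type*} [Field F] {k : ℕ} (M : Matrix (Fin k) (Fin k) F) :
    ∑ σ : Equiv.Perm (Fin k), ((1 : Matrix (Fin k) (Fin k) F) + permMat F σ * M).det
      = ∑ ρ : Equiv.Perm (Fin k), (1 + ∑ i, M (ρ i) i) := by
  have h1 : ∀ ρ : Equiv.Perm (Fin k), 1 + ∑ i, M (ρ i) i =
      ∑ τ : Equiv.Perm (Fin k), ((Equiv.Perm.sign τ : ℤ) : F) *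
        ∏ i, ((1 : Matrix (Fin k) (Fin k) F) (τ i) i + M (ρ i) i) := by
    intro ρ
    have h := Matrix.det_one_add_replicateCol_mul_replicateRow (ι := Unit)
      (fun _ : Fin k => (1 : F)) (fun i => M (ρ i) i)
    rw [Matrix.det_apply'] at h
    simpa [Matrix.mul_apply, dotProduct] using h.symm
  simp_rw [h1, Matrix.det_apply', Matrix.add_apply, permMat_mul_apply_aux]
  rw [Finset.sum_comm, Finset.sum_comm (s := Finset.univ (α := Equiv.Perm (Fin k)))]
  rw [Finset.sum_comm]
  conv_rhs => rw [Finset.sum_comm]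
  refine Finset.sum_congr rfl fun τ _ => ?_
  rw [← Equiv.sum_comp ((Equiv.inv (Equiv.Perm (Fin k))).trans (Equiv.mulLeft τ))]
  simp

theorem main_aux {F : Type*} [Field F] {k : ℕ} (M : Matrix (Fin k) (Fin k) F)
    (hM : ∀ σ : Equiv.Perm (Fin k),
        ((1 : Matrix (Fin k) (Fin k) F) + permMat F σ * M).det = 0) :
    ((k - 1).factorial : F) * ((k : F) + ∑ i, ∑ j, M i j) = 0 := by
  cases k with
  | zero => simpa using hM 1
  | succ n =>
    have h := sum_det_aux M
    simp_rw [hM] at h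
    rw [Finset.sum_add_distrib, Finset.sum_comm] at h
    have h2 : ∀ i, ∑ ρ : Equiv.Perm (Fin (n + 1)), M (ρ i) i
        = (n.factorial : F) * ∑ j, M j i := fun i => sum_perm_apply_aux (fun j => M j i) i
    simp_rw [h2, ← Finset.mul_sum] at h
    rw [Finset.sum_comm] at h
    simp only [Finset.sum_const_zero, Finset.sum_const, Finset.card_univ, Fintype.card_perm,
      Fintype.card_fin, Nat.factorial_succ, nsmul_eq_mul, mul_one] at h
    rw [Nat.add_sub_cancel, h]
    push_cast
    ring

theorem main_aux2 {F : Type*} [Field F] {k : ℕ} (M : Matrix (Fin k) (Fin k) F)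
    (hM : ∀ σ : Equiv.Perm (Fin k),
        ((1 : Matrix (Fin k) (Fin k) F) + permMat F σ * M).det = 0)
    (hc : ringChar F = 0 ∨ k ≤ ringChar F) : ∑ i, ∑ j, M i j = -(k : F) := by
  have hk : k ≠ 0 := by
    rintro rfl
    simpa using hM 1
  have hf : ((k - 1).factorial : F) ≠ 0 := by
    rw [Ne, ringChar.spec]
    intro hd
    rcases CharP.char_is_prime_or_zero F (ringChar F) with hp | h0
    · rw [hp.dvd_factorial] at hd
      rcases hc with hc | hc
      · exact hp.ne_zero hc
      · omega
    · rw [h0] at hd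
      exact Nat.factorial_ne_zero _ (Nat.eq_zero_of_zero_dvd hd)
  have h := (mul_eq_zero.mp (main_aux M hM)).resolve_left hf
  exact eq_neg_of_add_eq_zero_right h

/-- if `-1` is an eigenvalue of `P·M` for every permutation matrix `P`,
then `(k-1)!·(k + Σ_{i,j} M_{ij}) = 0` in `F`; consequently, if `char F = 0` or
`char F ≥ k`, then `Σ_{i,j} M_{ij} = -k`, and in particular every such field satisfies
condition `Π_k`. -/
theorem stmt18 (F : Type*) [Field F] (k : ℕ) :
    (∀ M : Matrix (Fin k) (Fin k) F,
      (∀ σ : Equiv.Perm (Fin k),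
        ((1 : Matrix (Fin k) (Fin k) F) + permMat F σ * M).det = 0) →
      ((k - 1).factorial : F) * ((k : F) + ∑ i, ∑ j, M i j) = 0 ∧
      ((ringChar F = 0 ∨ k ≤ ringChar F) → ∑ i, ∑ j, M i j = -(k : F))) ∧
    ((ringChar F = 0 ∨ k ≤ ringChar F) → PiCond F k) := by
  exact ⟨fun M hM => ⟨main_aux M hM, main_aux2 M hM⟩, fun hc M _ hM => main_aux2 M hM hc⟩
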